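/- (Bounding client drift.) Let F_1, …, F_U : E → ℝ (U ≥ 1) each be differentiable, convex, and L-smooth (L > 0), define F(w) = (1/U)∑_{u=1}^U F_u(w), let θ* be a minimizer of F, and assume (1/U)∑_{u=1}^U ‖∇F_u(θ*)‖² ≤ σ*². Fix a starting point θ ∈ E, a number of local steps τ ≥ 1, a noise vector ϑ ∈ E, and a step size η with 0 ≤ η ≤ 1/(6τL). Define local iterates by x_u^{(0)} = θ and x_u^{(k+1)} = x_u^{(k)} − η·(∇F_u(x_u^{(k)}) + ϑ) for k = 0, …, τ−1. Then (1/U)·∑_{u=1}^U ∑_{k=0}^{τ−1} ‖x_u^{(k)} − θ‖² ≤ 12η²τ²(τ−1)²L·(F(θ) − F(θ*)) + 6η²τ²(τ−1)²σ*² + ((2τ³ + 3τ² + τ)/3)·η²‖ϑ‖². -/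

import Mathlib

open RealInnerProductSpace

theorem norm_add_sq_le_two_mul {G : Type*} [SeminormedAddCommGroup G] (a b : G) :
    ‖a + b‖ ^ 2 ≤ 2 * ‖a‖ ^ 2 + 2 * ‖b‖ ^ 2 := by
  have h := norm_add_le a b
  nlinarith [norm_nonneg (a + b), sq_nonneg (‖a‖ - ‖b‖)]

theorem Finset.sum_range_natCast_sq (n : ℕ) :
    ∑ k ∈ Finset.range n, (k : ℝ) ^ 2 = (n : ℝ) * (n - 1) * (2 * n - 1) / 6 := by
  induction n with
  | zero => simp
  | succ n ih => rw [Finset.sum_range_succ, ih]; push_cast; ring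

section GradientBounds

variable {E : Type*} [NormedAddCommGroup E] [InnerProductSpace ℝ E] [CompleteSpace E]

theorem Differentiable.hasDerivAt_comp_line {f : E → ℝ} (hf : Differentiable ℝ f) (x v : E)
    (t : ℝ) :
    HasDerivAt (fun s : ℝ => f (x + s • v)) ⟪gradient f (x + t • v), v⟫ t := by
  have h1 : HasDerivAt (fun s : ℝ => x + s • v) v t := by
    simpa using ((hasDerivAt_id t).smul_const v).const_add x
  simpa [Function.comp_def] using
    (hf (x + t • v)).hasGradientAt.hasFDerivAt.comp_hasDerivAt t h1

/-- First-order lower bound for convex functions. -/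
theorem ConvexOn.add_inner_gradient_le {f : E → ℝ} (hc : ConvexOn ℝ Set.univ f)
    (hf : Differentiable ℝ f) (x y : E) :
    f y + ⟪gradient f y, x - y⟫ ≤ f x := by
  have hline : ConvexOn ℝ Set.univ (fun s : ℝ => f (y + s • (x - y))) := by
    have h := hc.comp_affineMap (AffineMap.lineMap (k := ℝ) y x)
    simpa [Function.comp_def, AffineMap.lineMap_apply, add_comm] using h
  have h := hline.le_slope_of_hasDerivAt (Set.mem_univ (0 : ℝ)) (Set.mem_univ 1) zero_lt_one
    (hf.hasDerivAt_comp_line y (x - y) 0)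
  simp only [slope_def_field, zero_smul, one_smul, add_zero, add_sub_cancel, sub_zero,
    div_one] at h
  linarith

/-- Quadratic upper bound for functions with Lipschitz gradient. -/
theorem Differentiable.le_add_inner_gradient_add_sq {f : E → ℝ} (hf : Differentiable ℝ f) {L : ℝ}
    (hL : ∀ x y : E, ‖gradient f x - gradient f y‖ ≤ L * ‖x - y‖) (x v : E) :
    f (x + v) ≤ f x + ⟪gradient f x, v⟫ + L / 2 * ‖v‖ ^ 2 := by
  set φ : ℝ → ℝ := fun t =>
    f (x + t • v) - t * ⟪gradient f x, v⟫ - t ^ 2 * (L / 2 * ‖v‖ ^ 2) with hφ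
  have hd : ∀ t, HasDerivAt φ (⟪gradient f (x + t • v), v⟫ - ⟪gradient f x, v⟫
      - 2 * t * (L / 2 * ‖v‖ ^ 2)) t := by
    intro t
    have h1 := (hasDerivAt_id t).mul_const ⟪gradient f x, v⟫
    have h2 := (hasDerivAt_pow 2 t).mul_const (L / 2 * ‖v‖ ^ 2)
    simpa [hφ] using ((hf.hasDerivAt_comp_line x v t).fun_sub h1).fun_sub h2
  have hanti : AntitoneOn φ (Set.Icc 0 1) := by
    refine antitoneOn_of_deriv_nonpos (convex_Icc 0 1)
      (fun t _ => (hd t).continuousAt.continuousWithinAt)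
      (fun t _ => (hd t).differentiableAt.differentiableWithinAt) fun t ht => ?_
    rw [interior_Icc] at ht
    rw [(hd t).deriv, ← inner_sub_left]
    have h1 := real_inner_le_norm (gradient f (x + t • v) - gradient f x) v
    have h2 := hL (x + t • v) x
    rw [add_sub_cancel_left, norm_smul, Real.norm_of_nonneg ht.1.le] at h2
    have h3 := mul_le_mul_of_nonneg_right h2 (norm_nonneg v)
    linarith
  have h := hanti (Set.left_mem_Icc.2 zero_le_one) (Set.right_mem_Icc.2 zero_le_one) zero_le_one
  simp only [hφ, zero_smul, one_smul, add_zero, one_mul, zero_mul, one_pow, sub_zero,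
    zero_pow two_ne_zero] at h
  linarith

/-- For a convex function with `L`-Lipschitz gradient, the squared distance between gradients is
controlled by the Bregman divergence. -/
theorem ConvexOn.norm_gradient_sub_sq_le {f : E → ℝ} (hc : ConvexOn ℝ Set.univ f)
    (hf : Differentiable ℝ f) {L : ℝ} (hL0 : 0 < L)
    (hL : ∀ x y : E, ‖gradient f x - gradient f y‖ ≤ L * ‖x - y‖) (x y : E) :
    ‖gradient f x - gradient f y‖ ^ 2 ≤ 2 * L * (f x - f y - ⟪gradient f y, x - y⟫) := by
  set d := gradient f x - gradient f y with hd
  have h1 := hf.le_add_inner_gradient_add_sq hL x (-(L⁻¹ • d))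
  have h2 := hc.add_inner_gradient_le hf (x + -(L⁻¹ • d)) y
  have h3 : x + -(L⁻¹ • d) - y = (x - y) - L⁻¹ • d := by abel
  have h4 : ⟪gradient f x, d⟫ - ⟪gradient f y, d⟫ = ‖d‖ ^ 2 := by
    rw [← inner_sub_left, ← hd, real_inner_self_eq_norm_sq]
  rw [h3, inner_sub_right, real_inner_smul_right] at h2
  rw [inner_neg_right, real_inner_smul_right, norm_neg, norm_smul, Real.norm_of_nonneg
    (inv_nonneg.2 hL0.le)] at h1
  have h5 : L / 2 * (L⁻¹ * ‖d‖) ^ 2 = L⁻¹ / 2 * ‖d‖ ^ 2 := by field_simp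
  have h6 : L⁻¹ / 2 * ‖d‖ ^ 2 ≤ f x - f y - ⟪gradient f y, x - y⟫ := by
    have h7 := congrArg (L⁻¹ * ·) h4
    simp only [mul_sub] at h7
    linarith
  calc ‖d‖ ^ 2 = 2 * L * (L⁻¹ / 2 * ‖d‖ ^ 2) := by field_simp
    _ ≤ _ := by gcongr

/-- A gradient step with step size at most `2 / L` is nonexpansive. -/
theorem ConvexOn.norm_gradient_step_sub_le {f : E → ℝ} (hc : ConvexOn ℝ Set.univ f)
    (hf : Differentiable ℝ f) {L : ℝ} (hL0 : 0 < L)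
    (hL : ∀ x y : E, ‖gradient f x - gradient f y‖ ≤ L * ‖x - y‖) {η : ℝ} (hη : 0 ≤ η)
    (hηL : η * L ≤ 2) (x y : E) :
    ‖(x - y) - η • (gradient f x - gradient f y)‖ ≤ ‖x - y‖ := by
  have h1 := hc.norm_gradient_sub_sq_le hf hL0 hL x y
  have h2 := hc.norm_gradient_sub_sq_le hf hL0 hL y x
  rw [norm_sub_rev (gradient f y), ← neg_sub x y, inner_neg_right] at h2
  have h3 : ⟪x - y, gradient f x - gradient f y⟫
      = ⟪gradient f x, x - y⟫ - ⟪gradient f y, x - y⟫ := by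
    rw [real_inner_comm, inner_sub_left]
  have h4 : ‖gradient f x - gradient f y‖ ^ 2
      ≤ L * ⟪x - y, gradient f x - gradient f y⟫ := by
    rw [h3]; linarith
  refine (sq_le_sq₀ (norm_nonneg _) (norm_nonneg _)).1 ?_
  rw [norm_sub_sq_real, real_inner_smul_right, norm_smul, Real.norm_of_nonneg hη]
  have h5 := mul_le_mul_of_nonneg_left h4 (sq_nonneg η)
  have h6 : 0 ≤ ⟪x - y, gradient f x - gradient f y⟫ :=
    nonneg_of_mul_nonneg_right ((sq_nonneg _).trans h4) hL0
  have h7 := mul_le_mul_of_nonneg_right hηL (mul_nonneg hη h6)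
  nlinarith

/-- The iterates of perturbed gradient descent drift away at most linearly. -/
theorem ConvexOn.norm_noisy_gradient_iterate_sub_le {f : E → ℝ} (hc : ConvexOn ℝ Set.univ f)
    (hf : Differentiable ℝ f) {L : ℝ} (hL0 : 0 < L)
    (hL : ∀ x y : E, ‖gradient f x - gradient f y‖ ≤ L * ‖x - y‖) {η : ℝ} (hη : 0 ≤ η)
    (hηL : η * L ≤ 2) (θ ϑ : E) (τ : ℕ) (x : ℕ → E) (hx0 : x 0 = θ)
    (hx : ∀ k < τ, x (k + 1) = x k - η • (gradient f (x k) + ϑ)) (k : ℕ) (hk : k ≤ τ) :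
    ‖x k - θ‖ ≤ k * (η * ‖gradient f θ + ϑ‖) := by
  induction k with
  | zero => simp [hx0]
  | succ k ih =>
    have h1 : x (k + 1) - θ = ((x k - θ) - η • (gradient f (x k) - gradient f θ))
        - η • (gradient f θ + ϑ) := by
      rw [hx k (by omega)]; module
    have h2 := hc.norm_gradient_step_sub_le hf hL0 hL hη hηL (x k) θ
    have h3 := norm_sub_le ((x k - θ) - η • (gradient f (x k) - gradient f θ))
      (η • (gradient f θ + ϑ))
    rw [norm_smul, Real.norm_of_nonneg hη] at h3
    have h4 := ih (by omega)
    rw [h1]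
    push_cast
    linarith

theorem ConvexOn.sum_norm_noisy_gradient_iterate_sub_sq_le {f : E → ℝ}
    (hc : ConvexOn ℝ Set.univ f)
    (hf : Differentiable ℝ f) {L : ℝ} (hL0 : 0 < L)
    (hL : ∀ x y : E, ‖gradient f x - gradient f y‖ ≤ L * ‖x - y‖) {η : ℝ} (hη : 0 ≤ η)
    (hηL : η * L ≤ 2) (θ ϑ : E) (τ : ℕ) (x : ℕ → E) (hx0 : x 0 = θ)
    (hx : ∀ k < τ, x (k + 1) = x k - η • (gradient f (x k) + ϑ)) :
    ∑ k ∈ Finset.range τ, ‖x k - θ‖ ^ 2 ≤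
      (τ : ℝ) * (τ - 1) * (2 * τ - 1) / 6 * (η ^ 2 * ‖gradient f θ + ϑ‖ ^ 2) := by
  rw [← Finset.sum_range_natCast_sq, Finset.sum_mul]
  refine Finset.sum_le_sum fun k hk => ?_
  have h := hc.norm_noisy_gradient_iterate_sub_le hf hL0 hL hη hηL θ ϑ τ x hx0 hx k
    (Finset.mem_range.1 hk).le
  calc ‖x k - θ‖ ^ 2 ≤ (k * (η * ‖gradient f θ + ϑ‖)) ^ 2 := by gcongr
    _ = _ := by ring

/-- At a minimizer of a sum of differentiable functions the gradients sum to zero. -/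
theorem sum_inner_gradient_eq_zero_of_forall_sum_le {ι : Type*} [Fintype ι] {F : ι → E → ℝ}
    (hF : ∀ i, Differentiable ℝ (F i)) {a : E} (ha : ∀ w, ∑ i, F i a ≤ ∑ i, F i w) (v : E) :
    ∑ i, ⟪gradient (F i) a, v⟫ = 0 := by
  have hd : HasDerivAt (fun s : ℝ => ∑ i, F i (a + s • v)) (∑ i, ⟪gradient (F i) a, v⟫) 0 := by
    refine HasDerivAt.fun_sum fun i _ => ?_
    simpa using (hF i).hasDerivAt_comp_line a v 0
  refine IsLocalMin.hasDerivAt_eq_zero (Filter.Eventually.of_forall fun s => ?_) hd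
  simpa using ha (a + s • v)

end GradientBounds

/-- Bounding client drift: noisy local gradient-descent iterates with step size
`0 ≤ η ≤ 1/(6τL)` stay close to the round's starting point `θ`. -/
theorem client_drift_bound {E : Type*} [NormedAddCommGroup E]
    [InnerProductSpace ℝ E] [CompleteSpace E]
    (U : ℕ) (hU : 1 ≤ U) (F : Fin U → E → ℝ) (L : ℝ) (hL : 0 < L)
    (hdiff : ∀ u, Differentiable ℝ (F u))
    (hconv : ∀ u, ConvexOn ℝ Set.univ (F u))
    (hsmooth : ∀ u, ∀ x y : E, ‖gradient (F u) x - gradient (F u) y‖ ≤ L * ‖x - y‖)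
    (Fglob : E → ℝ) (hFglob : ∀ w : E, Fglob w = (1 / (U : ℝ)) * ∑ u : Fin U, F u w)
    (θstar : E) (hmin : ∀ θ : E, Fglob θstar ≤ Fglob θ)
    (σstar : ℝ)
    (hhet : (1 / (U : ℝ)) * ∑ u : Fin U, ‖gradient (F u) θstar‖ ^ 2 ≤ σstar ^ 2)
    (θ : E) (τ : ℕ) (hτ : 1 ≤ τ) (ϑ : E)
    (η : ℝ) (hη0 : 0 ≤ η) (hη1 : η ≤ 1 / (6 * (τ : ℝ) * L))
    (x : Fin U → ℕ → E)
    (hx0 : ∀ u, x u 0 = θ)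
    (hxstep : ∀ u, ∀ k < τ, x u (k + 1) = x u k - η • (gradient (F u) (x u k) + ϑ)) :
    (1 / (U : ℝ)) * ∑ u : Fin U, ∑ k ∈ Finset.range τ, ‖x u k - θ‖ ^ 2 ≤
      12 * η ^ 2 * (τ : ℝ) ^ 2 * ((τ : ℝ) - 1) ^ 2 * L * (Fglob θ - Fglob θstar) +
        6 * η ^ 2 * (τ : ℝ) ^ 2 * ((τ : ℝ) - 1) ^ 2 * σstar ^ 2 +
        ((2 * (τ : ℝ) ^ 3 + 3 * (τ : ℝ) ^ 2 + (τ : ℝ)) / 3) * η ^ 2 * ‖ϑ‖ ^ 2 := by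
  have hU0 : (0 : ℝ) < U := by exact_mod_cast hU
  have hτ1 : (1 : ℝ) ≤ τ := by exact_mod_cast hτ
  have hηL : η * L ≤ 2 := by
    rw [le_div_iff₀ (by positivity)] at hη1
    nlinarith [mul_nonneg hη0 hL.le]
  have hsum_min : ∀ w, ∑ u, F u θstar ≤ ∑ u, F u w := by
    intro w
    have h := hmin w
    rw [hFglob, hFglob] at h
    exact le_of_mul_le_mul_left h (by positivity)
  have hzero := sum_inner_gradient_eq_zero_of_forall_sum_le hdiff hsum_min (θ - θstar)
  set c : ℝ := (τ : ℝ) * (τ - 1) * (2 * τ - 1) / 6 with hc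
  have hc0 : 0 ≤ c := by
    have h1 : (0 : ℝ) ≤ τ - 1 := by linarith
    have h2 : (0 : ℝ) ≤ 2 * τ - 1 := by linarith
    positivity
  have hclient : ∀ u, ∑ k ∈ Finset.range τ, ‖x u k - θ‖ ^ 2 ≤
      c * η ^ 2 * (8 * L * (F u θ - F u θstar - ⟪gradient (F u) θstar, θ - θstar⟫)
        + 4 * ‖gradient (F u) θstar‖ ^ 2 + 2 * ‖ϑ‖ ^ 2) := by
    intro u
    refine ((hconv u).sum_norm_noisy_gradient_iterate_sub_sq_le (hdiff u) hL (hsmooth u) hη0 hηL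
      θ ϑ τ (x u) (hx0 u) (hxstep u)).trans ?_
    rw [← hc, ← mul_assoc]
    refine mul_le_mul_of_nonneg_left ?_ (mul_nonneg hc0 (sq_nonneg η))
    have h1 := norm_add_sq_le_two_mul (gradient (F u) θ) ϑ
    have h2 := norm_add_sq_le_two_mul (gradient (F u) θ - gradient (F u) θstar)
      (gradient (F u) θstar)
    rw [sub_add_cancel] at h2
    have h3 := (hconv u).norm_gradient_sub_sq_le (hdiff u) hL (hsmooth u) θ θstar
    linarith
  have hmean : (1 / (U : ℝ)) * ∑ u : Fin U, ∑ k ∈ Finset.range τ, ‖x u k - θ‖ ^ 2 ≤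
      c * η ^ 2 * (8 * L * (Fglob θ - Fglob θstar) + 4 * σstar ^ 2 + 2 * ‖ϑ‖ ^ 2) := by
    have h1 := mul_le_mul_of_nonneg_left (Finset.sum_le_sum fun u (_ : u ∈ Finset.univ) =>
      hclient u) (one_div_pos.2 hU0).le
    refine h1.trans ?_
    rw [← Finset.mul_sum, mul_left_comm]
    refine mul_le_mul_of_nonneg_left ?_ (mul_nonneg hc0 (sq_nonneg η))
    simp only [Finset.sum_add_distrib, ← Finset.mul_sum, Finset.sum_sub_distrib, hzero]
    have h2 : 1 / (U : ℝ) * ∑ _u : Fin U, ‖ϑ‖ ^ 2 = ‖ϑ‖ ^ 2 := by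
      simp [hU0.ne']
    rw [hFglob, hFglob]
    linarith
  refine hmean.trans ?_
  have hgap : 0 ≤ L * (Fglob θ - Fglob θstar) := mul_nonneg hL.le (sub_nonneg.2 (hmin θ))
  have hcτ : 2 * c ≤ 3 * ((τ : ℝ) ^ 2 * (τ - 1) ^ 2) := by
    rcases hτ.eq_or_lt with h | h
    · simp [hc, ← h]
    · have h2 : (2 : ℝ) ≤ τ := by exact_mod_cast h
      have h3 : (0 : ℝ) ≤ τ * (τ - 1) := mul_nonneg (by linarith) (by linarith)
      have h4 : (2 * τ - 1 : ℝ) ≤ 9 * (τ * (τ - 1)) := by nlinarith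
      have h5 := mul_le_mul_of_nonneg_left h4 h3
      rw [hc]
      linarith
  have hcn : 2 * c ≤ (2 * (τ : ℝ) ^ 3 + 3 * (τ : ℝ) ^ 2 + τ) / 3 := by
    rw [hc]
    nlinarith [sq_nonneg (τ : ℝ)]
  have h1 := mul_le_mul_of_nonneg_right hcτ (mul_nonneg (sq_nonneg η) hgap)
  have h2 := mul_le_mul_of_nonneg_right hcτ (mul_nonneg (sq_nonneg η) (sq_nonneg σstar))
  have h3 := mul_le_mul_of_nonneg_right hcn (mul_nonneg (sq_nonneg η) (sq_nonneg ‖ϑ‖))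
  linarith
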